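/- arXiv:2007.00844 — 2 statements merged into one kernel-verified Lean document; each statement's English description precedes it below -/
import Mathlib

section
/- Let M_1, ..., M_n be closed affine subspaces of a real Hilbert space H with M := ∩_{i=1}^n M_i nonempty, and for each i let M_i' denote the linear subspace parallel to M_i. Define c_i := c(M_i', ∩_{j=i+1}^n M_j') for i ∈ {1,...,n−1} and c := (1 − ∏_{i=1}^{n−1}(1 − c_i²))^{1/2}. Then c ∈ [0,1] and for every x_0 ∈ H and every k ∈ ℕ, ‖(P_{M_n} P_{M_{n-1}} ⋯ P_{M_1})^k(x_0) − P_M(x_0)‖ ≤ c^k ‖x_0 − P_M(x_0)‖. -/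
open RealInnerProductSpace

/-- `P` is the nearest-point projector onto the set `S`. -/
def IsProjOn {H : Type*} [NormedAddCommGroup H] [InnerProductSpace ℝ H]
    (S : Set H) (P : H → H) : Prop :=
  ∀ x, P x ∈ S ∧ ∀ y ∈ S, ‖x - P x‖ ≤ ‖x - y‖

/-- The cosine of the Friederichs angle between two (closed) linear subspaces. -/
noncomputable def friedrichsCos {H : Type*} [NormedAddCommGroup H]
    [InnerProductSpace ℝ H] (A B : Submodule ℝ H) : ℝ :=
  sSup {r : ℝ | ∃ a ∈ A ⊓ (A ⊓ B)ᗮ, ∃ b ∈ B ⊓ (A ⊓ B)ᗮ,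
    ‖a‖ = 1 ∧ ‖b‖ = 1 ∧ r = |⟪a, b⟫|}

lemma cpr_inner_zero {H : Type*} [NormedAddCommGroup H] [InnerProductSpace ℝ H]
    (w b : H) (h : ∀ t : ℝ, ‖w‖ ≤ ‖w - t • b‖) : ⟪w, b⟫ = 0 := by
  by_cases hb : b = 0
  · simp [hb]
  have hb' : 0 < ‖b‖ ^ 2 := by positivity
  have h1 := h (⟪w, b⟫ / ‖b‖ ^ 2)
  have h2 : ‖w‖ ^ 2 ≤ ‖w - (⟪w, b⟫ / ‖b‖ ^ 2) • b‖ ^ 2 := by gcongr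
  rw [norm_sub_sq_real, inner_smul_right, norm_smul, mul_pow, Real.norm_eq_abs, sq_abs] at h2
  have e : (⟪w, b⟫ / ‖b‖ ^ 2) ^ 2 * ‖b‖ ^ 2 = (⟪w, b⟫ / ‖b‖ ^ 2) * ⟪w, b⟫ := by
    field_simp
  rw [e] at h2
  have h3 : (⟪w, b⟫ / ‖b‖ ^ 2) * ⟪w, b⟫ ≤ 0 := by linarith
  have h4 : (⟪w, b⟫ / ‖b‖ ^ 2) * ⟪w, b⟫ = ⟪w, b⟫ ^ 2 / ‖b‖ ^ 2 := by ring
  rw [h4, div_le_iff₀ hb'] at h3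
  have : ⟪w, b⟫ ^ 2 = 0 := le_antisymm (by linarith) (sq_nonneg _)
  exact pow_eq_zero_iff (two_ne_zero) |>.1 this

lemma cpr_bdd {H : Type*} [NormedAddCommGroup H] [InnerProductSpace ℝ H]
    (A B : Submodule ℝ H) : ∀ r ∈ {r : ℝ | ∃ a ∈ A ⊓ (A ⊓ B)ᗮ, ∃ b ∈ B ⊓ (A ⊓ B)ᗮ,
    ‖a‖ = 1 ∧ ‖b‖ = 1 ∧ r = |⟪a, b⟫|}, r ≤ 1 := by
  rintro r ⟨a, -, b, -, ha, hb, rfl⟩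
  simpa [ha, hb] using abs_real_inner_le_norm a b

lemma cpr_cos_nonneg {H : Type*} [NormedAddCommGroup H] [InnerProductSpace ℝ H]
    (A B : Submodule ℝ H) : 0 ≤ friedrichsCos A B := by
  apply Real.sSup_nonneg
  rintro r ⟨a, -, b, -, ha, hb, rfl⟩
  positivity

lemma cpr_cos_le_one {H : Type*} [NormedAddCommGroup H] [InnerProductSpace ℝ H]
    (A B : Submodule ℝ H) : friedrichsCos A B ≤ 1 :=
  Real.sSup_le (cpr_bdd A B) zero_le_one

lemma cpr_inner_le {H : Type*} [NormedAddCommGroup H] [InnerProductSpace ℝ H]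
    (A B : Submodule ℝ H) (a b : H) (ha : a ∈ A) (ha' : a ∈ (A ⊓ B)ᗮ)
    (hb : b ∈ B) (hb' : b ∈ (A ⊓ B)ᗮ) : ⟪a, b⟫ ≤ friedrichsCos A B * (‖a‖ * ‖b‖) := by
  by_cases h0 : a = 0
  · simp [h0]
  by_cases h1 : b = 0
  · simp [h1]
  have h0' : 0 < ‖a‖ := norm_pos_iff.2 h0
  have h1' : 0 < ‖b‖ := norm_pos_iff.2 h1
  have := le_csSup ⟨1, cpr_bdd A B⟩ (a := |⟪‖a‖⁻¹ • a, ‖b‖⁻¹ • b⟫|)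
    ⟨‖a‖⁻¹ • a, ⟨A.smul_mem _ ha, Submodule.smul_mem _ _ ha'⟩, ‖b‖⁻¹ • b,
      ⟨B.smul_mem _ hb, Submodule.smul_mem _ _ hb'⟩,
      by rw [norm_smul, norm_inv, norm_norm, inv_mul_cancel₀ h0'.ne'],
      by rw [norm_smul, norm_inv, norm_norm, inv_mul_cancel₀ h1'.ne'], rfl⟩
  change _ ≤ friedrichsCos A B at this
  have h2 := (le_abs_self _).trans this
  rw [inner_smul_left, inner_smul_right] at h2
  simp only [conj_trivial] at h2
  have h3 : ‖a‖⁻¹ * (‖b‖⁻¹ * ⟪a, b⟫) * (‖a‖ * ‖b‖) = ⟪a, b⟫ := by field_simp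
  rw [← h3]
  gcongr

lemma cpr_const {H : Type*} [NormedAddCommGroup H] [InnerProductSpace ℝ H]
    (A : ℕ → Submodule ℝ H) (n i : ℕ) (u : ℕ → H) (b : H)
    (hb : ∀ j ∈ Finset.Icc (i + 1) n, b ∈ A j)
    (hu : ∀ j ∈ Finset.Icc (i + 1) n, u j ∈ A j ∧ ∀ a ∈ A j, ⟪u (j - 1) - u j, a⟫ = 0)
    (d : ℕ) (hd : i + d ≤ n) : ⟪u (i + d), b⟫ = ⟪u i, b⟫ := by
  induction d with
  | zero => rfl
  | succ d ih =>
    rw [← ih (by omega)]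
    have hm : i + (d + 1) ∈ Finset.Icc (i + 1) n := by simp; omega
    have := (hu _ hm).2 b (hb _ hm)
    rw [show i + (d + 1) - 1 = i + d by omega, inner_sub_left] at this
    linarith

lemma cpr_prod (c : ℕ → ℝ) (s : Finset ℕ) (h0 : ∀ i ∈ s, 0 ≤ c i) (h1 : ∀ i ∈ s, c i ≤ 1) :
    0 ≤ ∏ i ∈ s, (1 - c i ^ 2) ∧ ∏ i ∈ s, (1 - c i ^ 2) ≤ 1 := by
  have h : ∀ i ∈ s, 0 ≤ 1 - c i ^ 2 := fun i hi => by nlinarith [h0 i hi, h1 i hi]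
  exact ⟨Finset.prod_nonneg h, Finset.prod_le_one h fun i hi => by nlinarith [sq_nonneg (c i)]⟩

lemma cpr_main {H : Type*} [NormedAddCommGroup H] [InnerProductSpace ℝ H] [CompleteSpace H]
    (n : ℕ) (A : ℕ → Submodule ℝ H) (hA : ∀ j ∈ Finset.Icc 1 n, IsClosed (A j : Set H))
    (c : ℕ → ℝ)
    (hc : ∀ i ∈ Finset.Ico 1 n, c i = friedrichsCos (A i) (⨅ j ∈ Finset.Icc (i + 1) n, A j))
    (d : ℕ) : ∀ i, i + 1 + d = n → ∀ u : ℕ → H,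
    (∀ j ∈ Finset.Icc (i + 1) n, u j ∈ A j ∧ ∀ a ∈ A j, ⟪u (j - 1) - u j, a⟫ = 0) →
    (∀ b, (∀ j ∈ Finset.Icc (i + 1) n, b ∈ A j) → ⟪u i, b⟫ = 0) →
    ‖u n‖ ^ 2 ≤ (1 - ∏ j ∈ Finset.Ico (i + 1) n, (1 - c j ^ 2)) * ‖u i‖ ^ 2 := by
  induction d with
  | zero =>
    intro i hi u hu hb
    obtain rfl : n = i + 1 := by omega
    have h1 := hu (i + 1) (by simp)
    have h2 := hb (u (i + 1)) (by simpa using h1.1)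
    have h3 := h1.2 _ h1.1
    rw [inner_sub_left, Nat.add_sub_cancel, h2, real_inner_self_eq_norm_sq] at h3
    have h4 : ‖u (i + 1)‖ ^ 2 = 0 := by linarith
    rw [h4]; simp
  | succ d ih =>
    intro i hi u hu hb
    set B : Submodule ℝ H := ⨅ j ∈ Finset.Icc (i + 1 + 1) n, A j with hB
    have memB : ∀ b, b ∈ B ↔ ∀ j ∈ Finset.Icc (i + 1 + 1) n, b ∈ A j := by
      intro b; simp only [hB, Submodule.mem_iInf]
    have hBc : IsClosed (B : Set H) := by
      have : (B : Set H) = ⋂ j ∈ Finset.Icc (i + 1 + 1) n, (A j : Set H) := by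
        ext b; simp only [SetLike.mem_coe, memB, Set.mem_iInter]
      rw [this]
      refine isClosed_biInter fun j hj => hA j ?_
      simp at hj ⊢; omega
    haveI : CompleteSpace B := hBc.completeSpace_coe
    have hsub : ∀ j ∈ Finset.Icc (i + 1 + 1) n, j ∈ Finset.Icc (i + 1) n := by
      intro j hj; simp at hj ⊢; omega
    have hmem : i + 1 ∈ Finset.Icc (i + 1) n := by simp; omega
    have hN : ∀ b, b ∈ A (i + 1) → b ∈ B → ∀ j ∈ Finset.Icc (i + 1) n, b ∈ A j := by
      intro b h1 h2 j hj
      rcases eq_or_ne j (i + 1) with rfl | hne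
      · exact h1
      · refine (memB b).1 h2 j ?_
        simp at hj ⊢; omega
    obtain ⟨hyA, hyo⟩ := hu _ hmem
    rw [Nat.add_sub_cancel] at hyo
    set y := u (i + 1) with hy
    have hyN : ∀ b, b ∈ A (i + 1) → b ∈ B → ⟪y, b⟫ = 0 := by
      intro b h1 h2
      have e1 := hyo b h1
      have e2 := hb b (hN b h1 h2)
      rw [inner_sub_left] at e1; linarith
    obtain ⟨q, hqB, hq⟩ : ∃ q ∈ B, ∀ b ∈ B, ⟪y - q, b⟫ = 0 := by
      refine ⟨B.starProjection y, Submodule.starProjection_apply_mem _ _, fun b h => ?_⟩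
      exact Submodule.starProjection_inner_eq_zero _ _ h
    have hih := ih (i + 1) (by omega) (fun j => u j - q) (by
      intro j hj
      refine ⟨Submodule.sub_mem _ (hu j (hsub j hj)).1 ((memB q).1 hqB j hj), fun a ha => ?_⟩
      have := (hu j (hsub j hj)).2 a ha
      simpa using this) (by
      intro b hb'
      exact hq b ((memB b).2 hb'))
    change ‖u n - q‖ ^ 2 ≤ _ * ‖y - q‖ ^ 2 at hih
    have hconst : ⟪u n, q⟫ = ⟪y, q⟫ := by
      have := cpr_const A n (i + 1) u q ((memB q).1 hqB) (fun j hj => hu j (hsub j hj))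
        (n - (i + 1)) (by omega)
      rwa [show i + 1 + (n - (i + 1)) = n by omega] at this
    have hyq : ⟪y, q⟫ = ‖q‖ ^ 2 := by
      have := hq q hqB
      rw [inner_sub_left, real_inner_self_eq_norm_sq] at this; linarith
    rw [norm_sub_sq_real, norm_sub_sq_real, hconst, hyq] at hih
    have hci := hc (i + 1) (by simp; omega)
    have hqy : ‖q‖ ^ 2 ≤ c (i + 1) * (‖y‖ * ‖q‖) := by
      rw [← hyq, hci]
      apply cpr_inner_le
      · exact hyA
      · rw [Submodule.mem_orthogonal']; exact fun b hb => hyN b hb.1 hb.2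
      · exact hqB
      · rw [Submodule.mem_orthogonal']
        intro b hb
        have e1 := hyN b hb.1 hb.2
        have e2 := hq b hb.2
        rw [inner_sub_left] at e2; linarith
    have hc0 : 0 ≤ c (i + 1) := hci ▸ cpr_cos_nonneg _ _
    have hc1 : c (i + 1) ≤ 1 := hci ▸ cpr_cos_le_one _ _
    have hqy' : ‖q‖ ≤ c (i + 1) * ‖y‖ := by
      rcases (norm_nonneg q).eq_or_lt with h | h
      · rw [← h]; positivity
      · nlinarith
    have hqy2 : ‖q‖ ^ 2 ≤ c (i + 1) ^ 2 * ‖y‖ ^ 2 := by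
      rw [← mul_pow]; gcongr
    have hyu : ‖y‖ ^ 2 ≤ ‖u i‖ ^ 2 := by
      have e := hyo y hyA
      rw [inner_sub_left, real_inner_self_eq_norm_sq] at e
      have := sq_nonneg ‖u i - y‖
      rw [norm_sub_sq_real] at this
      linarith
    rw [Finset.prod_eq_prod_Ico_succ_bot (by omega : i + 1 < n)]
    obtain ⟨g0, g1⟩ := cpr_prod c (Finset.Ico (i + 1 + 1) n)
      (fun j hj => by
        rw [hc j (by simp at hj ⊢; omega)]; exact cpr_cos_nonneg _ _)
      (fun j hj => by
        rw [hc j (by simp at hj ⊢; omega)]; exact cpr_cos_le_one _ _)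
    set g := ∏ j ∈ Finset.Ico (i + 1 + 1) n, (1 - c j ^ 2)
    have hc2 : c (i + 1) ^ 2 ≤ 1 := by nlinarith
    have k1 : 0 ≤ 1 - (1 - c (i + 1) ^ 2) * g := by nlinarith [sq_nonneg (c (i + 1))]
    calc ‖u n‖ ^ 2 ≤ (1 - g) * ‖y‖ ^ 2 + g * ‖q‖ ^ 2 := by linarith
      _ ≤ (1 - g) * ‖y‖ ^ 2 + g * (c (i + 1) ^ 2 * ‖y‖ ^ 2) := by gcongr
      _ = (1 - (1 - c (i + 1) ^ 2) * g) * ‖y‖ ^ 2 := by ring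
      _ ≤ _ := by gcongr

/-- Convergence rate of the method of cyclic projections for affine subspaces with
constant `c = (1 − ∏_{i=1}^{n-1}(1 - cᵢ²))^{1/2}`, where
`cᵢ = c(Mᵢ', ∩_{j=i+1}^n Mⱼ')` are cosines of the Friederichs angles between
the parallel linear subspaces. -/
theorem cyclic_projections_rate
    {H : Type*} [NormedAddCommGroup H] [InnerProductSpace ℝ H] [CompleteSpace H]
    (n : ℕ) (hn : 1 ≤ n)
    (M : ℕ → AffineSubspace ℝ H)
    (hclosed : ∀ i ∈ Finset.Icc 1 n, IsClosed (M i : Set H))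
    (hne : (⋂ i ∈ Finset.Icc 1 n, (M i : Set H)).Nonempty)
    (P : ℕ → H → H)
    (hP : ∀ i ∈ Finset.Icc 1 n, IsProjOn (M i : Set H) (P i))
    (PM : H → H)
    (hPM : IsProjOn (⋂ i ∈ Finset.Icc 1 n, (M i : Set H)) PM)
    (Q : ℕ → H → H)
    (hQ0 : Q 0 = id)
    (hQ : ∀ i, 1 ≤ i → i ≤ n → Q i = P i ∘ Q (i - 1))
    (c : ℕ → ℝ)
    (hc : ∀ i ∈ Finset.Icc 1 (n - 1),
      c i = friedrichsCos ((M i).direction) (⨅ j ∈ Finset.Icc (i + 1) n, (M j).direction))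
    (C : ℝ)
    (hC : C = Real.sqrt (1 - ∏ i ∈ Finset.Icc 1 (n - 1), (1 - c i ^ 2)))
    (x0 : H) (k : ℕ) :
    0 ≤ C ∧ C ≤ 1 ∧ ‖(Q n)^[k] x0 - PM x0‖ ≤ C ^ k * ‖x0 - PM x0‖ := by
  have hIco : Finset.Icc 1 (n - 1) = Finset.Ico 1 n := by ext j; simp; omega
  rw [hIco] at hC hc
  obtain ⟨g0, g1⟩ := cpr_prod c (Finset.Ico 1 n)
    (fun j hj => by rw [hc j hj]; exact cpr_cos_nonneg _ _)
    (fun j hj => by rw [hc j hj]; exact cpr_cos_le_one _ _)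
  have hC0 : 0 ≤ C := hC ▸ Real.sqrt_nonneg _
  have hC2 : C ^ 2 = 1 - ∏ i ∈ Finset.Ico 1 n, (1 - c i ^ 2) := by
    rw [hC, Real.sq_sqrt (by linarith)]
  refine ⟨hC0, by nlinarith, ?_⟩
  set p := PM x0 with hp
  have hpM : ∀ j ∈ Finset.Icc 1 n, p ∈ M j := by
    have := (hPM x0).1
    simp only [Set.mem_iInter] at this
    exact this
  have hdc : ∀ j ∈ Finset.Icc 1 n, IsClosed ((M j).direction : Set H) := fun j hj =>
    (AffineSubspace.isClosed_direction_iff (M j)).2 (hclosed j hj)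
  -- the orbit of a point under one cycle
  have hu : ∀ x, ∀ j ∈ Finset.Icc (0 + 1) n, Q j x - p ∈ (M j).direction ∧
      ∀ a ∈ (M j).direction, ⟪(Q (j - 1) x - p) - (Q j x - p), a⟫ = 0 := by
    intro x j hj
    have hj' : 1 ≤ j ∧ j ≤ n := by simpa using hj
    have hj1 : j ∈ Finset.Icc 1 n := by simpa using hj
    have e : Q j x = P j (Q (j - 1) x) := by rw [hQ j hj'.1 hj'.2]; rfl
    obtain ⟨h1, h2⟩ := hP j hj1 (Q (j - 1) x)
    rw [← e] at h1 h2
    refine ⟨AffineSubspace.vsub_mem_direction h1 (hpM j hj1), fun a ha => ?_⟩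
    rw [sub_sub_sub_cancel_right]
    apply cpr_inner_zero
    intro t
    have := h2 (t • a + Q j x)
      (AffineSubspace.vadd_mem_of_mem_direction (Submodule.smul_mem _ t ha) h1)
    rwa [show Q (j - 1) x - (t • a + Q j x) = Q (j - 1) x - Q j x - t • a by abel] at this
  have hcycle : ∀ x, (∀ b, (∀ j ∈ Finset.Icc (0 + 1) n, b ∈ (M j).direction) →
      ⟪x - p, b⟫ = 0) → ‖Q n x - p‖ ≤ C * ‖x - p‖ ∧
      (∀ b, (∀ j ∈ Finset.Icc (0 + 1) n, b ∈ (M j).direction) → ⟪Q n x - p, b⟫ = 0) := by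
    intro x hx
    have hx0 : Q 0 x = x := by rw [hQ0]; rfl
    constructor
    · have := cpr_main n (fun j => (M j).direction) hdc c hc (n - 1) 0 (by omega)
        (fun j => Q j x - p) (hu x) (by simpa only [hx0] using hx)
      simp only [hx0, zero_add] at this
      rw [← hC2, ← mul_pow] at this
      exact le_of_sq_le_sq this (by positivity)
    · intro b hb
      have := cpr_const (fun j => (M j).direction) n 0 (fun j => Q j x - p) b hb (hu x) n
        (by omega)
      simp only [hx0, zero_add] at this
      rw [this]; exact hx b hb
  have hx0 : ∀ b, (∀ j ∈ Finset.Icc (0 + 1) n, b ∈ (M j).direction) → ⟪x0 - p, b⟫ = 0 := by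
    intro b hb
    apply cpr_inner_zero
    intro t
    have := (hPM x0).2 (t • b + p) (by
      simp only [Set.mem_iInter]
      intro j hj
      exact AffineSubspace.vadd_mem_of_mem_direction
        (Submodule.smul_mem _ t (hb j (by simpa using hj))) (hpM j hj))
    rwa [← hp, show x0 - (t • b + p) = x0 - p - t • b by abel] at this
  have key : ∀ k : ℕ, ‖(Q n)^[k] x0 - p‖ ≤ C ^ k * ‖x0 - p‖ ∧
      (∀ b, (∀ j ∈ Finset.Icc (0 + 1) n, b ∈ (M j).direction) →
        ⟪(Q n)^[k] x0 - p, b⟫ = 0) := by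
    intro k
    induction k with
    | zero => exact ⟨by simp, hx0⟩
    | succ k ih =>
      rw [Function.iterate_succ_apply']
      obtain ⟨h1, h2⟩ := hcycle _ ih.2
      refine ⟨h1.trans ?_, h2⟩
      rw [pow_succ', mul_assoc]
      exact mul_le_mul_of_nonneg_left ih.1 hC0
  exact (key k).1
end

section
/- Let M_1, M_2 be closed affine subspaces of a real Hilbert space H with M_1 ∩ M_2 nonempty. Let T := T_{M_2,M_1} T_{M_1,M_2}, where T_{C_1,C_2} := (1/2)(I + R_{C_2} R_{C_1}). Then P_{M_1} ∘ P_{Fix T} = P_{M_2} ∘ P_{Fix T} = P_{M_1 ∩ M_2}. -/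
open scoped RealInnerProductSpace in
lemma aux_min {H : Type*} [NormedAddCommGroup H] [InnerProductSpace ℝ H] (a d : H)
    (h : ∀ t : ℝ, ‖a‖ ≤ ‖a - t • d‖) : ⟪a, d⟫ = 0 := by
  by_cases hd : d = 0
  · simp [hd]
  have hd' : 0 < ‖d‖ ^ 2 := by positivity
  have h1 := pow_le_pow_left₀ (norm_nonneg a) (h (⟪a, d⟫ / ‖d‖ ^ 2)) 2
  rw [norm_sub_sq_real, inner_smul_right, norm_smul, mul_pow, Real.norm_eq_abs, sq_abs] at h1
  have h2 : (⟪a, d⟫ / ‖d‖ ^ 2) ^ 2 * ‖d‖ ^ 2 = ⟪a, d⟫ / ‖d‖ ^ 2 * ⟪a, d⟫ := by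
    field_simp
  have h3 : ⟪a, d⟫ / ‖d‖ ^ 2 * ⟪a, d⟫ = ⟪a, d⟫ ^ 2 / ‖d‖ ^ 2 := by ring
  rw [h2, h3] at h1
  have h4 : ⟪a, d⟫ ^ 2 / ‖d‖ ^ 2 ≤ 0 := by linarith
  rw [div_le_iff₀ hd', zero_mul] at h4
  exact pow_eq_zero_iff (two_ne_zero) |>.1 (le_antisymm h4 (sq_nonneg _))

open scoped RealInnerProductSpace in
lemma aux_uniq {H : Type*} [NormedAddCommGroup H] [InnerProductSpace ℝ H] {S : Set H} {P : H → H}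
    (hP : IsProjOn S P) (x m : H) (hm : m ∈ S) (h : ∀ z ∈ S, ⟪x - m, z - m⟫ = 0) : P x = m := by
  have h1 := pow_le_pow_left₀ (norm_nonneg _) ((hP x).2 m hm) 2
  have h2 := h _ (hP x).1
  have h3 : x - P x = (x - m) - (P x - m) := by abel
  rw [h3, norm_sub_sq_real, h2] at h1
  have h4 : ‖P x - m‖ ^ 2 = 0 := le_antisymm (by linarith) (sq_nonneg _)
  exact sub_eq_zero.1 (norm_eq_zero.1 (pow_eq_zero_iff (two_ne_zero) |>.1 h4))

lemma aux_line {H : Type*} [NormedAddCommGroup H] [InnerProductSpace ℝ H]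
    (M : AffineSubspace ℝ H) {a b c : H} (ha : a ∈ M) (hb : b ∈ M) (hc : c ∈ M) (t : ℝ) :
    a + t • (b - c) ∈ M := by
  have := M.smul_vsub_vadd_mem t hb hc ha
  simpa [add_comm] using this

open scoped RealInnerProductSpace in
lemma aux_orth {H : Type*} [NormedAddCommGroup H] [InnerProductSpace ℝ H]
    {M : AffineSubspace ℝ H} {P : H → H} (hP : IsProjOn (M : Set H) P) (x : H) {y z : H}
    (hy : y ∈ M) (hz : z ∈ M) : ⟪x - P x, y - z⟫ = 0 := by
  apply aux_min
  intro t
  have := (hP x).2 _ (aux_line M (hP x).1 hy hz t)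
  rwa [← sub_sub] at this

open scoped RealInnerProductSpace in
lemma aux_refl {H : Type*} [NormedAddCommGroup H] [InnerProductSpace ℝ H]
    {M : AffineSubspace ℝ H} {P : H → H} (hP : IsProjOn (M : Set H) P) (x : H) {c : H}
    (hc : c ∈ M) : ‖(2 : ℝ) • P x - x - c‖ = ‖x - c‖ := by
  have h := aux_orth hP x (hP x).1 hc
  have e1 : (2 : ℝ) • P x - x - c = (P x - c) - (x - P x) := by module
  have e2 : x - c = (P x - c) + (x - P x) := by abel
  rw [← sq_eq_sq₀ (norm_nonneg _) (norm_nonneg _), e1, e2, norm_sub_sq_real, norm_add_sq_real,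
    real_inner_comm, h]
  ring

lemma aux_avg {H : Type*} [NormedAddCommGroup H] [InnerProductSpace ℝ H] (y v c : H)
    (h : ‖v - c‖ = ‖y - c‖) :
    ‖((1 : ℝ) / 2) • (y + v) - c‖ ^ 2 = ‖y - c‖ ^ 2 - ‖y - v‖ ^ 2 / 4 := by
  have e1 : ((1 : ℝ) / 2) • (y + v) - c = ((1 : ℝ) / 2) • ((y - c) + (v - c)) := by module
  have e2 : y - v = (y - c) - (v - c) := by abel
  rw [e1, e2, norm_smul, mul_pow, norm_add_sq_real, norm_sub_sq_real (y - c) (v - c), h]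
  norm_num
  ring

/-- For the symmetrised Douglas–Rachford operator `T = T_{M₂,M₁} T_{M₁,M₂}` of closed
affine subspaces with nonempty intersection:
`P_{M₁} ∘ P_{Fix T} = P_{M₂} ∘ P_{Fix T} = P_{M₁ ∩ M₂}`. -/
theorem symmetric_dr_shadow
    {H : Type*} [NormedAddCommGroup H] [InnerProductSpace ℝ H] [CompleteSpace H]
    (M1 M2 : AffineSubspace ℝ H)
    (hM1 : IsClosed (M1 : Set H)) (hM2 : IsClosed (M2 : Set H))
    (hne : ((M1 : Set H) ∩ (M2 : Set H)).Nonempty)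
    (P1 P2 : H → H)
    (hP1 : IsProjOn (M1 : Set H) P1) (hP2 : IsProjOn (M2 : Set H) P2)
    (R1 R2 : H → H)
    (hR1 : ∀ x, R1 x = (2 : ℝ) • P1 x - x) (hR2 : ∀ x, R2 x = (2 : ℝ) • P2 x - x)
    (T12 T21 : H → H)
    (hT12 : ∀ x, T12 x = ((1 : ℝ) / 2) • (x + R2 (R1 x)))
    (hT21 : ∀ x, T21 x = ((1 : ℝ) / 2) • (x + R1 (R2 x)))
    (PFix : H → H)
    (hPFix : IsProjOn {y : H | T21 (T12 y) = y} PFix)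
    (PM : H → H)
    (hPM : IsProjOn ((M1 : Set H) ∩ (M2 : Set H)) PM) :
    P1 ∘ PFix = PM ∧ P2 ∘ PFix = PM := by
  obtain ⟨c, hc1, hc2⟩ := hne
  have nR1 : ∀ x, ‖R1 x - c‖ = ‖x - c‖ := fun x => by rw [hR1]; exact aux_refl hP1 x hc1
  have nR2 : ∀ x, ‖R2 x - c‖ = ‖x - c‖ := fun x => by rw [hR2]; exact aux_refl hP2 x hc2
  -- forward: structure of fixed points
  have fwd : ∀ y, T21 (T12 y) = y → P1 y ∈ M1 ∧ P1 y ∈ M2 ∧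
      (∀ a ∈ M1, ∀ b ∈ M1, inner ℝ (y - P1 y) (a - b) = 0) ∧
      (∀ a ∈ M2, ∀ b ∈ M2, inner ℝ (y - P1 y) (a - b) = 0) := by
    intro y hy
    have h1 := aux_avg y (R2 (R1 y)) c (by rw [nR2, nR1])
    have h2 := aux_avg (T12 y) (R1 (R2 (T12 y))) c (by rw [nR1, nR2])
    rw [← hT12] at h1
    rw [← hT21, hy] at h2
    have h3 : ‖y - R2 (R1 y)‖ ^ 2 = 0 :=
      le_antisymm (by nlinarith [sq_nonneg ‖T12 y - R1 (R2 (T12 y))‖]) (sq_nonneg _)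
    have h4 : y = R2 (R1 y) :=
      sub_eq_zero.1 (norm_eq_zero.1 (pow_eq_zero_iff (two_ne_zero) |>.1 h3))
    have h5 : P2 (R1 y) = P1 y := by
      rw [hR2] at h4
      have h6 : (2 : ℝ) • P2 (R1 y) = (2 : ℝ) • P1 y := by
        have h7 : (2 : ℝ) • P2 (R1 y) = y + R1 y := by
          nth_rewrite 2 [h4]
          abel
        rw [h7, hR1]
        abel
      exact smul_right_injective H (two_ne_zero (α := ℝ)) h6
    refine ⟨(hP1 y).1, h5 ▸ (hP2 (R1 y)).1, fun a ha b hb => aux_orth hP1 y ha hb,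
      fun a ha b hb => ?_⟩
    have h8 := aux_orth hP2 (R1 y) hb ha
    rw [h5, hR1] at h8
    have e : (2 : ℝ) • P1 y - y - P1 y = -(y - P1 y) := by module
    rw [e, inner_neg_left, ← inner_neg_right, neg_sub] at h8
    exact h8
  have proj : ∀ y m, m ∈ M1 → m ∈ M2 →
      (∀ a ∈ M1, ∀ b ∈ M1, inner ℝ (y - m) (a - b) = 0) →
      (∀ a ∈ M2, ∀ b ∈ M2, inner ℝ (y - m) (a - b) = 0) → P1 y = m ∧ P2 y = m := by
    intro y m h1 h2 h3 h4
    exact ⟨aux_uniq hP1 y m h1 fun z hz => h3 z hz m h1,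
      aux_uniq hP2 y m h2 fun z hz => h4 z hz m h2⟩
  have bwd : ∀ y m, m ∈ M1 → m ∈ M2 →
      (∀ a ∈ M1, ∀ b ∈ M1, inner ℝ (y - m) (a - b) = 0) →
      (∀ a ∈ M2, ∀ b ∈ M2, inner ℝ (y - m) (a - b) = 0) → T21 (T12 y) = y := by
    intro y m h1 h2 h3 h4
    obtain ⟨q1, q2⟩ := proj y m h1 h2 h3 h4
    have e : (2 : ℝ) • m - y - m = -(y - m) := by module
    obtain ⟨q3, q4⟩ := proj ((2 : ℝ) • m - y) m h1 h2
      (fun a ha b hb => by rw [e, inner_neg_left, h3 a ha b hb, neg_zero])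
      (fun a ha b hb => by rw [e, inner_neg_left, h4 a ha b hb, neg_zero])
    have t1 : T12 y = y := by
      rw [hT12, hR1, q1, hR2, q4]
      module
    rw [t1, hT21, hR2, q2, hR1, q3]
    module
  have main : ∀ x, P1 (PFix x) = PM x ∧ P2 (PFix x) = PM x := by
    intro x
    obtain ⟨h1, h2, h3, h4⟩ := fwd (PFix x) (hPFix x).1
    have h5 := proj (PFix x) (P1 (PFix x)) h1 h2 h3 h4
    have h6 : PM x = P1 (PFix x) := by
      refine aux_uniq hPM x _ ⟨h1, h2⟩ ?_
      rintro z ⟨hz1, hz2⟩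
      have h7 : inner ℝ (x - PFix x) (z - P1 (PFix x)) = 0 := by
        apply aux_min
        intro t
        rw [sub_sub]
        apply (hPFix x).2
        have e : PFix x + t • (z - P1 (PFix x)) - (P1 (PFix x) + t • (z - P1 (PFix x)))
          = PFix x - P1 (PFix x) := by abel
        exact bwd _ (P1 (PFix x) + t • (z - P1 (PFix x))) (aux_line M1 h1 hz1 h1 t)
          (aux_line M2 h2 hz2 h2 t) (by rw [e]; exact h3) (by rw [e]; exact h4)
      have h8 := h3 z hz1 _ h1
      have e : x - P1 (PFix x) = (x - PFix x) + (PFix x - P1 (PFix x)) := by abel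
      rw [e, inner_add_left, h7, h8, add_zero]
    exact ⟨h6.symm, h5.2.trans h6.symm⟩
  exact ⟨funext fun x => (main x).1, funext fun x => (main x).2⟩
end
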